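/- Let m,n ≥ 2, X = {1,...,m} × {1,...,n}, P the partition of X into blocks C_i = {i} × {1,...,n}, and S = E(X,P) the submonoid of T(X,P) generated by its idempotents. For each i ∈ {1,...,m}, the set S \ E_n^{(i)} is an ideal of S; equivalently, for all g,h ∈ S, if gh ∈ E_n^{(i)} then both g ∈ E_n^{(i)} and h ∈ E_n^{(i)}. Consequently, any generating set of S contains a generating set of E_n^{(i)}. -/

import Mathlib

/-- `BP f` says that `f : X → X`, with `X = {1,…,m} × {1,…,n}`, preserves the partition of
`X` into the blocks `C_i = {i} × {1,…,n}`, i.e. `f ∈ T(X,P)`. -/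
def BP {m n : ℕ} (f : Fin m × Fin n → Fin m × Fin n) : Prop :=
  ∀ i : Fin m, ∃ j : Fin m, ∀ x : Fin n, (f (i, x)).1 = j

/-- `gi i g = g^{(i)} = [1,…,1,g,1,…,1; 1]`, with `g` in the `i`-th position. -/
def gi {m n : ℕ} (i : Fin m) (g : Fin n → Fin n) : Function.End (Fin m × Fin n) :=
  fun p => (p.1, if p.1 = i then g p.2 else p.2)

/-- `Eni m n i = E_n^{(i)} = {g^{(i)} : g ∈ E_n}`, where `E_n = {1} ∪ (T_n \ S_n)` is the
idempotent-generated submonoid of `T_n`. -/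
def Eni (m n : ℕ) (i : Fin m) : Set (Function.End (Fin m × Fin n)) :=
  {f | ∃ g : Fin n → Fin n, (g = id ∨ ¬ Function.Bijective g) ∧ f = gi i g}

theorem bijective_and_bijective_of_comp {α : Type*} [Finite α] {f g : α → α}
    (h : Function.Bijective (f ∘ g)) : Function.Bijective f ∧ Function.Bijective g :=
  ⟨Finite.surjective_iff_bijective.1 h.surjective.of_comp,
    Finite.injective_iff_bijective.1 h.injective.of_comp⟩

theorem eq_id_of_idempotent_of_injective {α : Type*} {f : α → α} (hf : ∀ x, f (f x) = f x)
    (hinj : Function.Injective f) : f = id :=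
  funext fun x => hinj (hf x)

/-- The submonoid of the full transformation monoid generated by its idempotents. -/
def idempotentClosure (α : Type*) : Submonoid (Function.End α) :=
  Submonoid.closure {f : Function.End α | f * f = f}

/-- The idempotent sending `a` to `b` and fixing every other point. -/
def collapse {α : Type*} [DecidableEq α] (a b : α) : α → α :=
  fun x => if x = a then b else x

theorem collapse_mem_idempotentClosure {α : Type*} [DecidableEq α] (a b : α) :
    collapse a b ∈ idempotentClosure α := by
  refine Submonoid.subset_closure (funext fun x => ?_)
  change collapse a b (collapse a b x) = collapse a b x
  unfold collapse
  split_ifs <;> simp_all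

theorem swap_comp_mem_idempotentClosure {α : Type*} [DecidableEq α] (a b : α) {u : α → α}
    (hu : ¬ Function.Surjective u) (hmem : u ∈ idempotentClosure α) :
    Equiv.swap a b ∘ u ∈ idempotentClosure α := by
  obtain ⟨c, hc⟩ := not_forall.1 hu
  have hc : ∀ x, u x ≠ c := fun x hx => hc ⟨x, hx⟩
  by_cases hca : c = a
  · have h : Equiv.swap a b ∘ u = collapse b a ∘ u := funext fun x => by
      have := hc x
      simp only [Function.comp_apply, collapse, Equiv.swap_apply_def]
      grind
    exact h ▸ mul_mem (collapse_mem_idempotentClosure b a) hmem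
  by_cases hcb : c = b
  · have h : Equiv.swap a b ∘ u = collapse a b ∘ u := funext fun x => by
      have := hc x
      simp only [Function.comp_apply, collapse, Equiv.swap_apply_def]
      grind
    exact h ▸ mul_mem (collapse_mem_idempotentClosure a b) hmem
  · have h : Equiv.swap a b ∘ u = collapse c b ∘ collapse b a ∘ collapse a c ∘ u :=
      funext fun x => by
        have := hc x
        simp only [Function.comp_apply, collapse, Equiv.swap_apply_def]
        grind
    exact h ▸ mul_mem (collapse_mem_idempotentClosure c b)
      (mul_mem (collapse_mem_idempotentClosure b a)
        (mul_mem (collapse_mem_idempotentClosure a c) hmem))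

theorem perm_comp_mem_idempotentClosure {α : Type*} [DecidableEq α] [Finite α]
    (σ : Equiv.Perm α) {u : α → α} (hu : ¬ Function.Surjective u)
    (hmem : u ∈ idempotentClosure α) : σ ∘ u ∈ idempotentClosure α := by
  induction σ using Equiv.Perm.swap_induction_on with
  | one => exact hmem
  | swap_mul τ a b _ ih =>
    refine swap_comp_mem_idempotentClosure a b (u := τ ∘ u) (fun h => hu ?_) ih
    exact (τ.comp_surjective u).1 h

/-- **Howie's theorem**: every singular transformation of a finite set is a product of
idempotents. -/
theorem mem_idempotentClosure_of_not_bijective {α : Type*} [DecidableEq α] [Fintype α]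
    {f : α → α} (hf : ¬ Function.Bijective f) : f ∈ idempotentClosure α := by
  have hs : ∀ y, ∃ x, y ∈ Set.range f → f x = y := fun y => by
    by_cases h : y ∈ Set.range f
    · exact ⟨h.choose, fun _ => h.choose_spec⟩
    · exact ⟨y, fun h' => absurd h' h⟩
  choose s hs using hs
  have hfs : ∀ x, f (s (f x)) = f x := fun x => hs _ ⟨x, rfl⟩
  have hinj : Set.InjOn f (Finset.univ.image (s ∘ f) : Finset α) := by
    intro x hx y hy hxy
    simp only [Finset.coe_image, Finset.coe_univ, Set.image_univ, Set.mem_range,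
      Function.comp_apply] at hx hy
    obtain ⟨x, rfl⟩ := hx
    obtain ⟨y, rfl⟩ := hy
    rw [hfs, hfs] at hxy
    rw [hxy]
  obtain ⟨τ, hτ⟩ := Finset.exists_equiv_extend_of_card_eq (t := (Finset.univ : Finset α))
    Finset.card_univ.symm (Finset.subset_univ _) hinj
  let σ : Equiv.Perm α := τ.trans (Equiv.subtypeUnivEquiv Finset.mem_univ)
  have hσ : f = σ ∘ (s ∘ f) := by
    funext x
    change f x = (τ (s (f x)) : α)
    exact (hfs x).symm.trans (hτ _ (Finset.mem_image.2 ⟨x, Finset.mem_univ _, rfl⟩)).symm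
  rw [hσ]
  refine perm_comp_mem_idempotentClosure σ (fun h => hf ?_) (Submonoid.subset_closure ?_)
  · rw [← Finite.surjective_iff_bijective, hσ]
    exact σ.surjective.comp h
  · exact funext fun x => congrArg s (hfs x)

/-- The embedding `g ↦ g^{(i)}` as a monoid homomorphism. -/
def giHom (m n : ℕ) (i : Fin m) : Function.End (Fin n) →* Function.End (Fin m × Fin n) where
  toFun g := gi i g
  map_one' := funext fun p => by
    change gi i id p = p
    simp [gi]
  map_mul' g h := funext fun p => by
    change gi i (g ∘ h) p = gi i g (gi i h p)
    by_cases hp : p.1 = i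
    · simp only [gi, hp, if_true]
      rfl
    · simp only [gi, hp, if_false]

theorem gi_mem_closure {m n : ℕ} (i : Fin m) {g : Fin n → Fin n}
    (hg : g ∈ idempotentClosure (Fin n)) :
    gi i g ∈ Submonoid.closure {f : Function.End (Fin m × Fin n) | BP f ∧ f * f = f} := by
  suffices h : idempotentClosure (Fin n) ≤ (Submonoid.closure
      {f : Function.End (Fin m × Fin n) | BP f ∧ f * f = f}).comap (giHom m n i) from h hg
  refine Submonoid.closure_le.2 fun e he => Submonoid.subset_closure
    ⟨fun j => ⟨j, fun _ => rfl⟩, ?_⟩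
  rw [← map_mul, he]

theorem Eni_subset_closure (m n : ℕ) (i : Fin m) :
    Eni m n i ⊆ (Submonoid.closure {f : Function.End (Fin m × Fin n) | BP f ∧ f * f = f} :
      Set (Function.End (Fin m × Fin n))) := by
  rintro _ ⟨g, hg, rfl⟩
  refine gi_mem_closure i ?_
  rcases hg with rfl | hg
  · exact one_mem (idempotentClosure (Fin n))
  · exact mem_idempotentClosure_of_not_bijective hg

/-- A product of partition-preserving idempotents has the form `[c_1,…,c_m; b]`, where `b` is
the identity if it is bijective, in which case the same holds for every `c_j`. -/
theorem exists_components_of_mem_closure {m n : ℕ} [NeZero n]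
    {f : Function.End (Fin m × Fin n)}
    (hf : f ∈ Submonoid.closure {f : Function.End (Fin m × Fin n) | BP f ∧ f * f = f}) :
    ∃ (b : Fin m → Fin m) (c : Fin m → Fin n → Fin n), (∀ j x, f (j, x) = (b j, c j x)) ∧
      (Function.Bijective b → b = id) ∧
      (b = id → ∀ j, Function.Bijective (c j) → c j = id) := by
  induction hf using Submonoid.closure_induction with
  | mem f hf =>
    obtain ⟨hBP, hidem⟩ := hf
    choose b hb using hBP
    have hf : ∀ j x, f (j, x) = (b j, (f (j, x)).2) := fun j x => Prod.ext (hb j x) rfl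
    have hff : ∀ p, f (f p) = f p := fun p => congrFun hidem p
    refine ⟨b, fun j x => (f (j, x)).2, hf, fun hbij => ?_, ?_⟩
    · refine eq_id_of_idempotent_of_injective (fun j => ?_) hbij.injective
      have h := hff (j, 0)
      rw [hf j 0, hf (b j)] at h
      exact congrArg Prod.fst h
    · rintro rfl j hbij
      refine eq_id_of_idempotent_of_injective (fun x => ?_) hbij.injective
      have h := congrArg Prod.snd (hff (j, x))
      rwa [hf j x] at h
  | one => exact ⟨id, fun _ => id, fun _ _ => rfl, fun _ => rfl, fun _ _ _ => rfl⟩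
  | mul f g _ _ hf hg =>
    obtain ⟨b, c, hf, hb, hc⟩ := hf
    obtain ⟨b', c', hg, hb', hc'⟩ := hg
    refine ⟨b ∘ b', fun j => c (b' j) ∘ c' j, fun j x => ?_, fun h => ?_, fun h j hj => ?_⟩
    · change f (g (j, x)) = _
      rw [hg, hf]
      rfl
    · obtain ⟨h₁, h₂⟩ := bijective_and_bijective_of_comp h
      rw [hb h₁, hb' h₂]
      rfl
    · obtain ⟨h₁, h₂⟩ := bijective_and_bijective_of_comp (h ▸ Function.bijective_id)
      obtain rfl := hb h₁
      obtain rfl := hb' h₂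
      obtain ⟨h₃, h₄⟩ := bijective_and_bijective_of_comp hj
      change c j ∘ c' j = id
      rw [hc rfl j h₃, hc' rfl j h₄]
      rfl

theorem mem_Eni_of_components {m n : ℕ} {i : Fin m} {f : Function.End (Fin m × Fin n)}
    {c : Fin m → Fin n → Fin n} (hf : ∀ j x, f (j, x) = (j, c j x))
    (hc : ∀ j, Function.Bijective (c j) → c j = id)
    (hbij : ∀ j, j ≠ i → Function.Bijective (c j)) : f ∈ Eni m n i := by
  refine ⟨c i, (em (Function.Bijective (c i))).imp (hc i) id, funext fun ⟨j, x⟩ => ?_⟩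
  rw [hf]
  by_cases hj : j = i
  · subst hj
    simp [gi]
  · simp [gi, hj, hc j (hbij j hj)]

theorem mem_Eni_of_mul_mem_Eni {m n : ℕ} [NeZero n] {i : Fin m}
    {g h : Function.End (Fin m × Fin n)}
    (hg : g ∈ Submonoid.closure {f : Function.End (Fin m × Fin n) | BP f ∧ f * f = f})
    (hh : h ∈ Submonoid.closure {f : Function.End (Fin m × Fin n) | BP f ∧ f * f = f})
    (hmul : h * g ∈ Eni m n i) : g ∈ Eni m n i ∧ h ∈ Eni m n i := by
  obtain ⟨b, c, hg, hb, hc⟩ := exists_components_of_mem_closure hg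
  obtain ⟨b', c', hh, hb', hc'⟩ := exists_components_of_mem_closure hh
  obtain ⟨k, -, hk⟩ := hmul
  have hk : ∀ j x, (b' (b j), c' (b j) (c j x)) = (j, if j = i then k x else x) := fun j x => by
    rw [← hh, ← hg]
    exact congrFun hk (j, x)
  have hbb : b' ∘ b = id := funext fun j => congrArg Prod.fst (hk j 0)
  obtain ⟨h₁, h₂⟩ := bijective_and_bijective_of_comp (hbb ▸ Function.bijective_id)
  obtain rfl := hb h₂
  obtain rfl := hb' h₁
  have hcc : ∀ j, j ≠ i → Function.Bijective (c' j) ∧ Function.Bijective (c j) := fun j hj => by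
    have : c' j ∘ c j = id := funext fun x => by
      simpa [hj] using congrArg Prod.snd (hk j x)
    exact bijective_and_bijective_of_comp (this ▸ Function.bijective_id)
  exact ⟨mem_Eni_of_components hg (hc rfl) fun j hj => (hcc j hj).2,
    mem_Eni_of_components hh (hc' rfl) fun j hj => (hcc j hj).1⟩

theorem one_mem_Eni (m n : ℕ) (i : Fin m) : 1 ∈ Eni m n i :=
  ⟨id, Or.inl rfl, (map_one (giHom m n i)).symm⟩

theorem mul_mem_Eni {m n : ℕ} {i : Fin m} {f g : Function.End (Fin m × Fin n)}
    (hf : f ∈ Eni m n i) (hg : g ∈ Eni m n i) : f * g ∈ Eni m n i := by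
  obtain ⟨k, hk, rfl⟩ := hf
  obtain ⟨l, hl, rfl⟩ := hg
  refine ⟨k ∘ l, ?_, ((giHom m n i).map_mul k l).symm⟩
  by_cases h : Function.Bijective (k ∘ l)
  · obtain ⟨h₁, h₂⟩ := bijective_and_bijective_of_comp h
    rw [hk.resolve_right (not_not.2 h₁), hl.resolve_right (not_not.2 h₂)]
    exact Or.inl rfl
  · exact Or.inr h

/-- For `m, n ≥ 2` and each `i`, the set `S \ E_n^{(i)}` is an ideal of the
idempotent-generated submonoid `S = E(X,P)` of `T(X,P)`: whenever `g, h ∈ S` and the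
product `gh` (here `g` acting first, i.e. the composite `h * g` of `Function.End`) lies in
`E_n^{(i)}`, both `g` and `h` lie in `E_n^{(i)}`.  Consequently, every generating set of `S`
contains a generating set of `E_n^{(i)}`. -/
theorem stmt_14 (m n : ℕ) (hm : 2 ≤ m) (hn : 2 ≤ n) (i : Fin m) :
    (∀ g h : Function.End (Fin m × Fin n),
      g ∈ Submonoid.closure {f : Function.End (Fin m × Fin n) | BP f ∧ f * f = f} →
      h ∈ Submonoid.closure {f : Function.End (Fin m × Fin n) | BP f ∧ f * f = f} →
      h * g ∈ Eni m n i → g ∈ Eni m n i ∧ h ∈ Eni m n i) ∧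
    ∀ G : Set (Function.End (Fin m × Fin n)),
      Submonoid.closure G
        = Submonoid.closure {f : Function.End (Fin m × Fin n) | BP f ∧ f * f = f} →
      ∃ H ⊆ G, (Submonoid.closure H : Set (Function.End (Fin m × Fin n))) = Eni m n i := by
  have : NeZero n := ⟨by omega⟩
  refine ⟨fun g h hg hh hmul => mem_Eni_of_mul_mem_Eni hg hh hmul, fun G hG =>
    ⟨G ∩ Eni m n i, Set.inter_subset_left, Set.Subset.antisymm (fun f hf => ?_) fun f hf => ?_⟩⟩
  · induction hf using Submonoid.closure_induction with
    | mem f hf => exact hf.2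
    | one => exact one_mem_Eni m n i
    | mul f g _ _ hf hg => exact mul_mem_Eni hf hg
  · have hfG : f ∈ Submonoid.closure G := hG ▸ Eni_subset_closure m n i hf
    induction hfG using Submonoid.closure_induction with
    | mem f hfG => exact Submonoid.subset_closure ⟨hfG, hf⟩
    | one => exact one_mem _
    | mul f g hfG hgG ihf ihg =>
      obtain ⟨h₁, h₂⟩ := mem_Eni_of_mul_mem_Eni (hG ▸ hgG) (hG ▸ hfG) hf
      exact mul_mem (ihf h₂) (ihg h₁)
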